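/- It is decidable whether a given k-automatic sequence is ultimately periodic. Precisely: there is an algorithm that, given an integer k ≥ 2 and a DFAO M = (Q, Σ_k, Δ, δ, q0, τ) generating a k-automatic sequence a = (a_n)_{n≥0}, decides whether there exist integers P ≥ 1 and N ≥ 0 such that a_i = a_{i+P} for all i ≥ N. -/

import Mathlib

/-- Run an encoded DFAO transition table from state `q` on a list of base-`k`
digits, least significant digit first (this is `w^R` for a most-significant-first
representation `w`). -/
def dfaoRun (trans : List (List ℕ)) : ℕ → List ℕ → ℕ
  | q, [] => q
  | q, d :: ds => dfaoRun trans ((trans.getD q []).getD d 0) ds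

/-- The encoded DFAO `(trans, q0, out)` over input alphabet `Σ_k = {0,…,k-1}`
generates the sequence `a`: for every `m` and every base-`k` representation `w`
of `m` (given least significant digit first, possibly with trailing zeros,
all digits `< k`), the output on `w` is `a m`. -/
def dfaoGenerates (k : ℕ) (trans : List (List ℕ)) (q0 : ℕ) (out : List ℕ)
    (a : ℕ → ℕ) : Prop :=
  ∀ (m : ℕ) (w : List ℕ), (∀ d ∈ w, d < k) → Nat.ofDigits k w = m →
    a m = out.getD (dfaoRun trans q0 w) 0

/-- `a` is ultimately periodic: there exist `P ≥ 1` and `N ≥ 0` with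
`a i = a (i + P)` for all `i ≥ N`. -/
def UltimatelyPeriodic (a : ℕ → ℕ) : Prop :=
  ∃ P : ℕ, 1 ≤ P ∧ ∃ N : ℕ, ∀ i : ℕ, N ≤ i → a i = a (i + P)

/-- `p` is an eventual period of `a`. -/
def EventualPeriod (a : ℕ → ℕ) (p : ℕ) : Prop :=
  ∃ N : ℕ, ∀ i : ℕ, N ≤ i → a i = a (i + p)

theorem EventualPeriod.mul {a : ℕ → ℕ} {p : ℕ} (h : EventualPeriod a p) (c : ℕ) :
    EventualPeriod a (p * c) := by
  obtain ⟨N, hN⟩ := h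
  refine ⟨N, fun i hi => ?_⟩
  induction c with
  | zero => simp
  | succ c ih => rw [ih, hN _ (by omega)]; congr 1; ring

/-- An autonomous sequence in a finite set is periodic from the cardinality of the set on. -/
theorem exists_periodic_of_mem_finset {α : Type*} (x : ℕ → α) (A : Finset α)
    (hx : ∀ l, x l ∈ A) (hF : ∀ i j, x i = x j → x (i + 1) = x (j + 1)) :
    ∃ p, 1 ≤ p ∧ p ≤ A.card ∧ ∀ l, A.card ≤ l → ∀ c, x (l + p * c) = x l := by
  obtain ⟨i, hi, j, hj, hij, hxe⟩ :=
    Finset.exists_ne_map_eq_of_card_lt_of_maps_to (s := Finset.range (A.card + 1)) (t := A)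
      (by simp) (f := x) (fun l _ => hx l)
  wlog h : i < j generalizing i j
  · exact this j hj i hi hij.symm hxe.symm (by omega)
  simp only [Finset.mem_range] at hi hj
  have key : ∀ m, x (i + m) = x (j + m) := by
    intro m
    induction m with
    | zero => exact hxe
    | succ m ih => exact hF _ _ ih
  refine ⟨j - i, by omega, by omega, fun l hl c => ?_⟩
  induction c with
  | zero => simp
  | succ c ih =>
    rw [← ih]
    have := key (l + (j - i) * c - i)
    rw [show i + (l + (j - i) * c - i) = l + (j - i) * c by omega] at this
    rw [this]
    congr 1
    rw [Nat.mul_succ]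
    omega

theorem exists_large_eq {α : Type*} (x : ℕ → α) (A : Finset α)
    (hx : ∀ l, x l ∈ A) (hF : ∀ i j, x i = x j → x (i + 1) = x (j + 1))
    {l : ℕ} (hl : A.card ≤ l) (L : ℕ) : ∃ l', L ≤ l' ∧ x l' = x l := by
  obtain ⟨p, hp, -, h⟩ := exists_periodic_of_mem_finset x A hx hF
  exact ⟨l + p * L, by nlinarith, h l hl L⟩

theorem exists_small_eq {α : Type*} (x : ℕ → α) (A : Finset α)
    (hx : ∀ l, x l ∈ A) (hF : ∀ i j, x i = x j → x (i + 1) = x (j + 1))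
    {l : ℕ} (hl : A.card ≤ l) : ∃ l', A.card ≤ l' ∧ l' ≤ 2 * A.card ∧ x l' = x l := by
  obtain ⟨p, hp, hpA, h⟩ := exists_periodic_of_mem_finset x A hx hF
  have hlt := Nat.mod_lt (l - A.card) hp
  refine ⟨A.card + (l - A.card) % p, by omega, by omega, ?_⟩
  rw [← h _ (by omega) ((l - A.card) / p)]
  congr 1
  have := Nat.mod_add_div (l - A.card) p
  omega

/-- The sequences `s q`, for `q < S`, are closed under taking sections modulo `k`:
the section of `s q` at the digit `d` is `s (step q d)`, except possibly at `0`. -/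
structure IsSectionFamily (k S : ℕ) (step s : ℕ → ℕ → ℕ) : Prop where
  two_le : 2 ≤ k
  step_lt : ∀ q < S, ∀ d < k, step q d < S
  section_eq : ∀ q n d, 1 ≤ n → d < k → s q (k * n + d) = s (step q d) n

namespace IsSectionFamily

variable {k S : ℕ} {step s : ℕ → ℕ → ℕ}

theorem exists_iterated_section (H : IsSectionFamily k S step s) (e : ℕ) :
    ∀ q < S, ∀ r < k ^ e, ∃ q' < S, ∀ n, 1 ≤ n → s q (k ^ e * n + r) = s q' n := by
  have hk := H.two_le
  induction e with
  | zero =>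
    intro q hq r hr
    exact ⟨q, hq, fun n _ => by simp_all⟩
  | succ e ih =>
    intro q hq r hr
    have hd := Nat.mod_lt r (show 0 < k by omega)
    obtain ⟨q', hq', h⟩ := ih (step q (r % k)) (H.step_lt q hq _ hd) (r / k)
      (Nat.div_lt_of_lt_mul (by rwa [pow_succ'] at hr))
    refine ⟨q', hq', fun n hn => ?_⟩
    have hpos : 0 < k ^ e := by positivity
    rw [← h n hn, ← H.section_eq q _ _ (le_add_right (Nat.mul_pos hpos hn)) hd]
    congr 1
    conv_lhs => rw [← Nat.div_add_mod r k]
    ring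

theorem exists_eventualPeriod_factorial_mul_pow (H : IsSectionFamily k S step s) {q p : ℕ}
    (hq : q < S) (hp : 1 ≤ p) (h : EventualPeriod (s q) p) :
    ∃ E, EventualPeriod (s q) (S.factorial * k ^ E) := by
  have hk := H.two_le
  obtain ⟨E, f, hf, hdvd⟩ : ∃ E f, 1 ≤ f ∧ p ∣ k ^ E * (k ^ f - 1) := by
    have : NeZero p := ⟨by omega⟩
    obtain ⟨i, j, hij, he⟩ :=
      Finite.exists_ne_map_eq_of_infinite (fun i : ℕ => ((k ^ i : ℕ) : ZMod p))
    wlog hlt : i < j generalizing i j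
    · exact this j i hij.symm he.symm (by omega)
    refine ⟨i, j - i, by omega, ?_⟩
    have := (Nat.modEq_iff_dvd' (Nat.pow_le_pow_right (by omega) hlt.le)).1
      ((ZMod.natCast_eq_natCast_iff _ _ _).1 he)
    rwa [Nat.mul_sub, ← pow_add, mul_one, Nat.add_sub_cancel' hlt.le]
  obtain ⟨c, hc⟩ := hdvd
  have hper := h.mul c
  rw [← hc] at hper
  clear hc h
  refine ⟨E, ?_⟩
  obtain ⟨m, hm⟩ : ∃ m, k ^ f = m + 1 := Nat.exists_eq_add_of_le' (Nat.one_le_pow _ _ (by omega))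
  have hm1 : 1 ≤ m := by
    have := Nat.pow_le_pow_right (show 0 < k by omega) hf
    rw [pow_one] at this
    omega
  rw [hm, Nat.add_sub_cancel] at hper
  obtain ⟨g, hg⟩ : ∃ g, k ^ (f * (S + 1)) = 1 + m * g := by
    obtain ⟨g, hg⟩ := Nat.sub_dvd_pow_sub_pow (m + 1) 1 (S + 1)
    rw [one_pow, Nat.add_sub_cancel] at hg
    refine ⟨g, ?_⟩
    rw [← hg, pow_mul, hm]
    have : 0 < (m + 1) ^ (S + 1) := by positivity
    omega
  have hlarge : S + 1 ≤ k ^ (f * (S + 1)) :=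
    calc S + 1 ≤ f * (S + 1) := by nlinarith
      _ ≤ k ^ (f * (S + 1)) := (Nat.lt_pow_self (by omega)).le
  obtain ⟨N, hN⟩ : ∃ N, ∀ c i, N ≤ i → s q i = s q (i + k ^ E * m * c) := by
    obtain ⟨N, hN⟩ := hper
    refine ⟨N, fun c i hi => ?_⟩
    induction c with
    | zero => simp
    | succ c ih => rw [ih, hN _ (by omega)]; congr 1; ring
  have hE : 0 < k ^ E := by positivity
  have hδ : ∀ r < k ^ E, ∃ δ, 1 ≤ δ ∧ δ ≤ S ∧ ∀ y, 1 ≤ y → N ≤ r + k ^ E * y →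
      s q (r + k ^ E * y) = s q (r + k ^ E * (y + δ)) := by
    intro r hr
    have hsec : ∀ t : ℕ, ∃ q' < S, t < S + 1 →
        ∀ n, 1 ≤ n → s q (k ^ (E + f * (S + 1)) * n + (r + k ^ E * t)) = s q' n := by
      intro t
      by_cases ht : t < S + 1
      · obtain ⟨q', hq', h⟩ := H.exists_iterated_section (E + f * (S + 1)) q hq (r + k ^ E * t) (by
          rw [pow_add]; nlinarith)
        exact ⟨q', hq', fun _ => h⟩
      · exact ⟨q, hq, fun h => absurd h ht⟩
    choose st hst hsteq using hsec
    obtain ⟨t, ht, t', ht', hne, he⟩ :=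
      Finset.exists_ne_map_eq_of_card_lt_of_maps_to (s := Finset.range (S + 1))
        (t := Finset.range S) (by simp) (f := st) (fun l _ => by simpa using hst l)
    wlog hlt : t < t' generalizing t t'
    · exact this t' ht' t ht hne.symm he.symm (by omega)
    simp only [Finset.mem_range] at ht ht'
    refine ⟨t' - t, by omega, by omega, fun y hy hNy => ?_⟩
    obtain ⟨δ, rfl⟩ := Nat.exists_eq_add_of_lt hlt
    obtain ⟨m, rfl⟩ := Nat.exists_eq_add_of_le' hm1
    have h1 := hsteq t ht (y + t * m) (by omega)
    have h2 := hsteq (t + δ + 1) ht' (y + t * m) (by omega)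
    rw [← he, ← h1] at h2
    have h3 := hN (g * (y + t * m) + t) (r + k ^ E * y) hNy
    have h4 := hN (g * (y + t * m) + t) (r + k ^ E * (y + (t + δ + 1 - t))) (by
      have : k ^ E * y ≤ k ^ E * (y + (t + δ + 1 - t)) := Nat.mul_le_mul_left _ (by omega)
      omega)
    rw [h3, h4]
    rw [pow_add, hg] at h2
    convert h2.symm using 2
    · ring
    · rw [show t + δ + 1 - t = δ + 1 by omega]; ring
  refine ⟨N + k ^ E, fun i hi => ?_⟩
  obtain ⟨δ, h1, h2, h3⟩ := hδ (i % k ^ E) (Nat.mod_lt _ hE)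
  obtain ⟨u, hu⟩ := Nat.dvd_factorial h1 h2
  have hmd := Nat.mod_add_div i (k ^ E)
  have hy : 1 ≤ i / k ^ E := (Nat.one_le_div_iff hE).2 (by omega)
  have hrep : ∀ c, s q i = s q (i % k ^ E + k ^ E * (i / k ^ E + δ * c)) := by
    intro c
    induction c with
    | zero => simp [hmd]
    | succ c ih =>
      rw [ih, h3 _ (by omega)]
      · congr 1; ring
      · rw [Nat.mul_add]; omega
  rw [hrep u]
  congr 1
  conv_rhs => rw [← hmd, hu]
  ring

theorem eventualPeriod_mul_pow_succ_iff (H : IsSectionFamily k S step s) (M l q : ℕ) :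
    EventualPeriod (s q) (M * k ^ (l + 1)) ↔
      ∀ d < k, EventualPeriod (s (step q d)) (M * k ^ l) := by
  have hk := H.two_le
  constructor
  · rintro ⟨N, hN⟩ d hd
    refine ⟨N + 1, fun n hn => ?_⟩
    rw [← H.section_eq q n d (by omega) hd, ← H.section_eq q _ d (by omega) hd,
      hN _ (by nlinarith)]
    congr 1; ring
  · intro h
    have h' : ∀ d, ∃ N, d < k → ∀ i, N ≤ i →
        s (step q d) i = s (step q d) (i + M * k ^ l) := by
      intro d
      by_cases hd : d < k
      · obtain ⟨N, hN⟩ := h d hd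
        exact ⟨N, fun _ => hN⟩
      · exact ⟨0, fun h => absurd h hd⟩
    choose N hN using h'
    refine ⟨k * ((Finset.range k).sup N + 1), fun i hi => ?_⟩
    have hd := Nat.mod_lt i (show 0 < k by omega)
    have hn : (Finset.range k).sup N + 1 ≤ i / k :=
      (Nat.le_div_iff_mul_le (by omega)).2 (by rwa [mul_comm])
    have hle : N (i % k) ≤ (Finset.range k).sup N :=
      Finset.le_sup (Finset.mem_range.2 hd)
    have h1 := H.section_eq q (i / k) (i % k) (by omega) hd
    have h2 := H.section_eq q (i / k + M * k ^ l) (i % k) (by omega) hd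
    rw [← hN _ hd _ (by omega), ← h1, Nat.div_add_mod] at h2
    rw [← h2]
    congr 1
    rw [pow_succ]
    linarith [Nat.div_add_mod i k]

theorem eventualPeriod_mul_two_pow (H : IsSectionFamily k S step s) {q M E : ℕ} (hq : q < S)
    (h : EventualPeriod (s q) (M * k ^ E)) : EventualPeriod (s q) (M * k ^ 2 ^ S) := by
  classical
  let G : ℕ → Finset ℕ := fun l =>
    (Finset.range S).filter fun q => EventualPeriod (s q) (M * k ^ l)
  have hG : ∀ i j, G i = G j → G (i + 1) = G (j + 1) := by
    intro i j hij
    refine Finset.filter_congr fun x hx => ?_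
    rw [H.eventualPeriod_mul_pow_succ_iff, H.eventualPeriod_mul_pow_succ_iff]
    refine forall₂_congr fun d hd => ?_
    have hlt := H.step_lt x (Finset.mem_range.1 hx) d hd
    simpa [G, hlt] using Finset.ext_iff.1 hij (step x d)
  obtain ⟨l, hl, he⟩ := exists_large_eq G (Finset.range S).powerset
    (fun l => Finset.mem_powerset.2 (Finset.filter_subset _ _)) hG
    (l := 2 ^ S) (by simp) E
  have hmem : q ∈ G l := by
    refine Finset.mem_filter.2 ⟨Finset.mem_range.2 hq, ?_⟩
    have := h.mul (k ^ (l - E))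
    rwa [mul_assoc, ← pow_add, Nat.add_sub_cancel' hl] at this
  rw [he] at hmem
  exact (Finset.mem_filter.1 hmem).2

/-- Failures of the period `P` on numbers with `l + 1` digits recur: they are detected
on a bounded range of `l`. -/
theorem eventualPeriod_iff_forall_lt (H : IsSectionFamily k S step s) {q : ℕ} (hq : q < S)
    (P : ℕ) : EventualPeriod (s q) P ↔
      ∀ i < k ^ (2 * 2 ^ (S * (S * (P + 1))) + 1), k ^ 2 ^ (S * (S * (P + 1))) ≤ i →
        s q i = s q (i + P) := by
  classical
  have hk := H.two_le
  let X : Finset (ℕ × ℕ × ℕ) := Finset.range S ×ˢ Finset.range S ×ˢ Finset.range (P + 1)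
  let bad : ℕ → ℕ × ℕ × ℕ → Prop := fun l x =>
    ∃ n, k ^ l ≤ n ∧ n < k ^ (l + 1) ∧ s x.1 n ≠ s x.2.1 (n + x.2.2)
  let next : ℕ × ℕ × ℕ → ℕ → ℕ × ℕ × ℕ := fun x d =>
    (step x.1 d, step x.2.1 ((d + x.2.2) % k), (d + x.2.2) / k)
  let V : ℕ → Finset (ℕ × ℕ × ℕ) := fun l => X.filter (bad l)
  have hnext : ∀ x ∈ X, ∀ d < k, next x d ∈ X := by
    rintro ⟨q₁, q₂, c⟩ hx d hd
    simp only [X, next, Finset.mem_product, Finset.mem_range] at hx ⊢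
    refine ⟨H.step_lt _ hx.1 _ hd, H.step_lt _ hx.2.1 _ (Nat.mod_lt _ (by omega)), ?_⟩
    exact Nat.div_lt_of_lt_mul (by nlinarith)
  have hsplit : ∀ x : ℕ × ℕ × ℕ, ∀ n d, 1 ≤ n → d < k →
      (s x.1 (k * n + d) ≠ s x.2.1 (k * n + d + x.2.2) ↔
        s (next x d).1 n ≠ s (next x d).2.1 (n + (next x d).2.2)) := by
    intro x n d hn hd
    rw [H.section_eq _ _ _ hn hd]
    have := H.section_eq x.2.1 (n + (d + x.2.2) / k) ((d + x.2.2) % k) (le_add_right hn)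
      (Nat.mod_lt _ (by omega))
    rw [← this, show k * (n + (d + x.2.2) / k) + (d + x.2.2) % k = k * n + d + x.2.2 by
      rw [mul_add, add_assoc, Nat.div_add_mod]; ring]
  have hbad : ∀ l x, bad (l + 1) x ↔ ∃ d < k, bad l (next x d) := by
    intro l x
    have hpos : 0 < k ^ l := by positivity
    constructor
    · rintro ⟨n, h1, h2, h3⟩
      have hd := Nat.mod_lt n (show 0 < k by omega)
      have hn : k ^ l ≤ n / k := (Nat.le_div_iff_mul_le (by omega)).2 h1
      refine ⟨n % k, hd, n / k, hn, Nat.div_lt_of_lt_mul (by rwa [← pow_succ']), ?_⟩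
      rw [← hsplit x _ _ (by omega) hd, Nat.div_add_mod]
      exact h3
    · rintro ⟨d, hd, n, h1, h2, h3⟩
      refine ⟨k * n + d, ?_, ?_, (hsplit x n d (by omega) hd).2 h3⟩
      · rw [pow_succ']; nlinarith
      · rw [pow_succ']; nlinarith
  have hV : ∀ i j, V i = V j → V (i + 1) = V (j + 1) := by
    intro i j hij
    refine Finset.filter_congr fun x hx => ?_
    rw [hbad, hbad]
    refine exists_congr fun d => and_congr_right fun hd => ?_
    simpa [V, hnext x hx d hd] using Finset.ext_iff.1 hij (next x d)
  have hVmem : ∀ l, V l ∈ X.powerset := fun l =>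
    Finset.mem_powerset.2 (Finset.filter_subset _ _)
  have hcard : X.powerset.card = 2 ^ (S * (S * (P + 1))) := by simp [X]
  have hx0 : (q, q, P) ∈ X := by simp [X, hq]
  rw [← hcard]
  have hlog : ∀ i, 0 < i → k ^ Nat.log k i ≤ i ∧ i < k ^ (Nat.log k i + 1) := fun i hi =>
    ⟨Nat.pow_log_le_self k (by omega), Nat.lt_pow_succ_log_self (by omega) i⟩
  constructor
  · rintro ⟨N, hN⟩ i - h2
    by_contra hne
    have hi : 0 < i := lt_of_lt_of_le (by positivity) h2
    have hl : X.powerset.card ≤ Nat.log k i :=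
      (Nat.le_log_iff_pow_le (by omega) (by omega)).2 h2
    have hmem : (q, q, P) ∈ V (Nat.log k i) :=
      Finset.mem_filter.2 ⟨hx0, i, (hlog i hi).1, (hlog i hi).2, hne⟩
    obtain ⟨l, hl', he⟩ := exists_large_eq V _ hVmem hV hl N
    rw [← he] at hmem
    obtain ⟨-, n, h3, -, h5⟩ := Finset.mem_filter.1 hmem
    exact h5 (hN n (hl'.trans ((Nat.lt_pow_self (by omega)).le.trans h3)))
  · intro h
    refine ⟨k ^ X.powerset.card, fun i h2 => ?_⟩
    by_contra hne
    have hi : 0 < i := lt_of_lt_of_le (by positivity) h2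
    have hl : X.powerset.card ≤ Nat.log k i :=
      (Nat.le_log_iff_pow_le (by omega) (by omega)).2 h2
    have hmem : (q, q, P) ∈ V (Nat.log k i) :=
      Finset.mem_filter.2 ⟨hx0, i, (hlog i hi).1, (hlog i hi).2, hne⟩
    obtain ⟨l, hl1, hl2, he⟩ := exists_small_eq V _ hVmem hV hl
    rw [← he] at hmem
    obtain ⟨-, n, h3, h4, h5⟩ := Finset.mem_filter.1 hmem
    exact h5 (h n (h4.trans_le (Nat.pow_le_pow_right (by omega) (by omega)))
      ((Nat.pow_le_pow_right (by omega) hl1).trans h3))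

theorem ultimatelyPeriodic_iff_eventualPeriod (H : IsSectionFamily k S step s) {q : ℕ}
    (hq : q < S) :
    UltimatelyPeriodic (s q) ↔ EventualPeriod (s q) (S.factorial * k ^ 2 ^ S) := by
  have hk := H.two_le
  constructor
  · rintro ⟨p, hp, h⟩
    obtain ⟨E, hE⟩ := H.exists_eventualPeriod_factorial_mul_pow hq hp h
    exact H.eventualPeriod_mul_two_pow hq hE
  · intro h
    exact ⟨_, Nat.mul_pos (Nat.factorial_pos _) (by positivity), h⟩

end IsSectionFamily

/-- The successor of state `q` on the digit `d` in an encoded transition table. -/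
def dfaoStep (trans : List (List ℕ)) (q d : ℕ) : ℕ :=
  (trans.getD q []).getD d 0

/-- The state reached after reading the `t` least significant base-`k` digits of `n`. -/
def dfaoRunDigits (k : ℕ) (trans : List (List ℕ)) (q n t : ℕ) : ℕ :=
  ((fun x : ℕ × ℕ => (dfaoStep trans x.1 (x.2 % k), x.2 / k))^[t] (q, n)).1

/-- The output of an encoded DFAO on `n`, read with `n` digits (some of them leading zeros). -/
def dfaoValue (k : ℕ) (trans : List (List ℕ)) (q0 : ℕ) (out : List ℕ) (n : ℕ) : ℕ :=
  out.getD (dfaoRunDigits k trans q0 n n) 0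

theorem exists_word_dfaoRunDigits {k : ℕ} (hk : 0 < k) (trans : List (List ℕ)) (t : ℕ) :
    ∀ q n, n < k ^ t → ∃ w : List ℕ, (∀ d ∈ w, d < k) ∧ Nat.ofDigits k w = n ∧
      dfaoRunDigits k trans q n t = dfaoRun trans q w := by
  induction t with
  | zero => intro q n hn; exact ⟨[], by simp_all [dfaoRunDigits, dfaoRun]⟩
  | succ t ih =>
    intro q n hn
    obtain ⟨w, h1, h2, h3⟩ := ih (dfaoStep trans q (n % k)) (n / k)
      (Nat.div_lt_of_lt_mul (by rwa [← pow_succ']))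
    refine ⟨n % k :: w, ?_, ?_, ?_⟩
    · simpa [Nat.mod_lt _ hk] using h1
    · rw [Nat.ofDigits_cons, h2, Nat.mod_add_div]
    · exact h3

theorem dfaoGenerates.eq_dfaoValue {k : ℕ} {trans : List (List ℕ)} {q0 : ℕ} {out : List ℕ}
    {a : ℕ → ℕ} (hk : 2 ≤ k) (h : dfaoGenerates k trans q0 out a) (n : ℕ) :
    a n = dfaoValue k trans q0 out n := by
  obtain ⟨w, h1, h2, h3⟩ := exists_word_dfaoRunDigits (show 0 < k by omega) trans n q0 n
    (Nat.lt_pow_self (by omega))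
  rw [dfaoValue, h3, h n w h1 h2]

theorem Encodable.encode_le_encode_of_mem {α : Type*} [Encodable α] {x : α} {l : List α}
    (h : x ∈ l) : Encodable.encode x ≤ Encodable.encode l := by
  induction l with
  | nil => simp at h
  | cons y l ih =>
    rw [Encodable.encode_list_cons]
    rcases List.mem_cons.1 h with rfl | h
    · exact (Nat.left_le_pair _ _).trans (Nat.le_succ _)
    · exact (ih h).trans ((Nat.right_le_pair _ _).trans (Nat.le_succ _))

theorem Encodable.getD_le_encode (l : List ℕ) (d : ℕ) : l.getD d 0 ≤ Encodable.encode l := by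
  by_cases h : d < l.length
  · rw [List.getD_eq_getElem _ _ h]
    exact Encodable.encode_le_encode_of_mem (List.getElem_mem h)
  · rw [List.getD_eq_default _ _ (by omega)]
    exact Nat.zero_le _

theorem dfaoStep_le (trans : List (List ℕ)) (q d : ℕ) :
    dfaoStep trans q d ≤ Encodable.encode trans := by
  refine (Encodable.getD_le_encode _ d).trans ?_
  by_cases h : q < trans.length
  · rw [List.getD_eq_getElem _ _ h]
    exact Encodable.encode_le_encode_of_mem (List.getElem_mem h)
  · rw [List.getD_eq_default _ _ (by omega)]
    exact Nat.zero_le _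

theorem isSectionFamily_digits {k : ℕ} (hk : 2 ≤ k) (trans : List (List ℕ)) (q0 : ℕ)
    (out : List ℕ) :
    IsSectionFamily k (q0 + Encodable.encode trans + 1) (dfaoStep trans)
      (fun q n => out.getD (dfaoRun trans q (k.digits n)) 0) where
  two_le := hk
  step_lt q _ d _ := by have := dfaoStep_le trans q d; omega
  section_eq q n d hn hd := by
    rw [add_comm, Nat.digits_add k (by omega) d n hd (Or.inr (by omega))]
    rfl

theorem dfaoGenerates.eq_digits {k : ℕ} {trans : List (List ℕ)} {q0 : ℕ} {out : List ℕ}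
    {a : ℕ → ℕ} (hk : 2 ≤ k) (h : dfaoGenerates k trans q0 out a) (n : ℕ) :
    a n = out.getD (dfaoRun trans q0 (k.digits n)) 0 :=
  h n _ (fun _ hd => Nat.digits_lt_base (by omega) hd) (Nat.ofDigits_digits k n)

/-- A bound on the states reachable in an encoded DFAO. -/
def dfaoStateBound (x : ℕ × List (List ℕ) × ℕ × List ℕ) : ℕ :=
  x.2.2.1 + Encodable.encode x.2.1 + 1

/-- An eventual period of the generated sequence, if it is ultimately periodic. -/
def dfaoPeriod (x : ℕ × List (List ℕ) × ℕ × List ℕ) : ℕ :=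
  (dfaoStateBound x).factorial * x.1 ^ 2 ^ dfaoStateBound x

/-- A bound on the preperiod in terms of digit length. -/
def dfaoLengthBound (x : ℕ × List (List ℕ) × ℕ × List ℕ) : ℕ :=
  2 ^ (dfaoStateBound x * (dfaoStateBound x * (dfaoPeriod x + 1)))

/-- The bounded test deciding ultimate periodicity. -/
def DfaoPeriodicTest (x : ℕ × List (List ℕ) × ℕ × List ℕ) : Prop :=
  ∀ i < x.1 ^ (2 * dfaoLengthBound x + 1), x.1 ^ dfaoLengthBound x ≤ i →
    dfaoValue x.1 x.2.1 x.2.2.1 x.2.2.2 i = dfaoValue x.1 x.2.1 x.2.2.1 x.2.2.2 (i + dfaoPeriod x)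

theorem dfaoGenerates.periodicTest_iff {k : ℕ} {trans : List (List ℕ)} {q0 : ℕ}
    {out : List ℕ} {a : ℕ → ℕ} (hk : 2 ≤ k) (h : dfaoGenerates k trans q0 out a) :
    DfaoPeriodicTest (k, trans, q0, out) ↔ UltimatelyPeriodic a := by
  have H := isSectionFamily_digits hk trans q0 out
  have hq : q0 < q0 + Encodable.encode trans + 1 := by omega
  have ha : a = fun n => out.getD (dfaoRun trans q0 (k.digits n)) 0 := funext (h.eq_digits hk)
  have key := (H.ultimatelyPeriodic_iff_eventualPeriod hq).trans
    (H.eventualPeriod_iff_forall_lt hq _)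
  simp only [← ha] at key
  rw [key]
  simp only [← h.eq_digits hk, h.eq_dfaoValue hk]
  rfl

theorem primrec_pow : Primrec₂ ((· ^ ·) : ℕ → ℕ → ℕ) :=
  Primrec₂.unpaired'.1 Nat.Primrec.pow

theorem primrec_factorial : Primrec Nat.factorial :=
  (Primrec.nat_rec₁ (f := fun n m => (n + 1) * m) 1
    (Primrec.nat_mul.comp (Primrec.succ.comp Primrec.fst) Primrec.snd)).of_eq
    fun n => by induction n with
      | zero => rfl
      | succ n ih => simp only [Nat.factorial_succ, ← ih]

theorem primrec_dfaoStateBound : Primrec dfaoStateBound :=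
  Primrec.succ.comp (Primrec.nat_add.comp
    (Primrec.fst.comp (Primrec.snd.comp Primrec.snd))
    (Primrec.encode.comp (Primrec.fst.comp Primrec.snd)))

theorem primrec_dfaoPeriod : Primrec dfaoPeriod :=
  Primrec.nat_mul.comp (primrec_factorial.comp primrec_dfaoStateBound)
    (primrec_pow.comp Primrec.fst (primrec_pow.comp (Primrec.const 2) primrec_dfaoStateBound))

theorem primrec_dfaoLengthBound : Primrec dfaoLengthBound :=
  primrec_pow.comp (Primrec.const 2) (Primrec.nat_mul.comp primrec_dfaoStateBound
    (Primrec.nat_mul.comp primrec_dfaoStateBound (Primrec.succ.comp primrec_dfaoPeriod)))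

theorem primrec_dfaoStep :
    Primrec fun x : List (List ℕ) × ℕ × ℕ => dfaoStep x.1 x.2.1 x.2.2 :=
  (Primrec.list_getD 0).comp
    ((Primrec.list_getD []).comp Primrec.fst (Primrec.fst.comp Primrec.snd))
    (Primrec.snd.comp Primrec.snd)

theorem primrec_dfaoValue :
    Primrec₂ fun (x : ℕ × List (List ℕ) × ℕ × List ℕ) (n : ℕ) =>
      dfaoValue x.1 x.2.1 x.2.2.1 x.2.2.2 n := by
  have hstep : Primrec₂ fun (y : (ℕ × List (List ℕ) × ℕ × List ℕ) × ℕ) (z : ℕ × ℕ) =>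
      (dfaoStep y.1.2.1 z.1 (z.2 % y.1.1), z.2 / y.1.1) := by
    have hk : Primrec fun p : ((ℕ × List (List ℕ) × ℕ × List ℕ) × ℕ) × ℕ × ℕ => p.1.1.1 :=
      Primrec.fst.comp (Primrec.fst.comp Primrec.fst)
    have hn : Primrec fun p : ((ℕ × List (List ℕ) × ℕ × List ℕ) × ℕ) × ℕ × ℕ => p.2.2 :=
      Primrec.snd.comp Primrec.snd
    have htrans : Primrec fun p : ((ℕ × List (List ℕ) × ℕ × List ℕ) × ℕ) × ℕ × ℕ => p.1.1.2.1 :=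
      Primrec.fst.comp (Primrec.snd.comp (Primrec.fst.comp Primrec.fst))
    exact (primrec_dfaoStep.comp (htrans.pair
      ((Primrec.fst.comp Primrec.snd).pair (Primrec.nat_mod.comp hn hk)))).pair
      (Primrec.nat_div.comp hn hk)
  have hout : Primrec fun p : (ℕ × List (List ℕ) × ℕ × List ℕ) × ℕ => p.1.2.2.2 :=
    Primrec.snd.comp (Primrec.snd.comp (Primrec.snd.comp Primrec.fst))
  have hq : Primrec fun p : (ℕ × List (List ℕ) × ℕ × List ℕ) × ℕ => p.1.2.2.1 :=
    Primrec.fst.comp (Primrec.snd.comp (Primrec.snd.comp Primrec.fst))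
  exact (Primrec.list_getD 0).comp hout
    (Primrec.fst.comp (Primrec.nat_iterate Primrec.snd (hq.pair Primrec.snd) hstep))

theorem primrecPred_dfaoPeriodicTest : PrimrecPred DfaoPeriodicTest := by
  have hrel : PrimrecRel fun (i : ℕ) (x : ℕ × List (List ℕ) × ℕ × List ℕ) =>
      ¬ x.1 ^ dfaoLengthBound x ≤ i ∨
        dfaoValue x.1 x.2.1 x.2.2.1 x.2.2.2 i =
          dfaoValue x.1 x.2.1 x.2.2.1 x.2.2.2 (i + dfaoPeriod x) := by
    refine PrimrecPred.or (PrimrecPred.not (Primrec.nat_le.comp ?_ Primrec.fst))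
      (Primrec.eq.comp ?_ ?_)
    · exact (primrec_pow.comp Primrec.fst primrec_dfaoLengthBound).comp Primrec.snd
    · exact primrec_dfaoValue.comp Primrec.snd Primrec.fst
    · exact primrec_dfaoValue.comp Primrec.snd
        (Primrec.nat_add.comp Primrec.fst (primrec_dfaoPeriod.comp Primrec.snd))
  have hbound : Primrec fun x : ℕ × List (List ℕ) × ℕ × List ℕ =>
      x.1 ^ (2 * dfaoLengthBound x + 1) :=
    primrec_pow.comp Primrec.fst (Primrec.succ.comp
      (Primrec.nat_mul.comp (Primrec.const 2) primrec_dfaoLengthBound))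
  refine (hrel.forall_mem_list.comp (Primrec.list_range.comp hbound) Primrec.id).of_eq
    fun x => ?_
  simp only [← imp_iff_not_or, List.mem_range]
  rfl

/-- Honkala's theorem: it is decidable, given `k ≥ 2` and a DFAO generating a
`k`-automatic sequence `a`, whether `a` is ultimately periodic. -/
theorem ultimatelyPeriodic_decidable :
    ∃ f : ℕ × List (List ℕ) × ℕ × List ℕ → Bool,
      Computable f ∧
      ∀ (k : ℕ) (trans : List (List ℕ)) (q0 : ℕ) (out : List ℕ) (a : ℕ → ℕ),
        2 ≤ k → dfaoGenerates k trans q0 out a →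
        (f (k, trans, q0, out) = true ↔ UltimatelyPeriodic a) := by
  obtain ⟨_, h⟩ := primrecPred_dfaoPeriodicTest
  exact ⟨_, h.to_comp, fun k trans q0 out a hk ha =>
    decide_eq_true_iff.trans (ha.periodicTest_iff hk)⟩
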